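/- arXiv:1909.02750 — 2 statements merged into one kernel-verified Lean document; each statement's English description precedes it below -/
import Mathlib

section
/- Let ε ∈ (0, 1], δ ∈ (0, 1), Δ ≥ 0, and set β = Δ·√(2·ln(1.25/δ))/ε. Let y, y′ ∈ ℝᵏ with ‖y − y′‖₂ ≤ Δ. Let ν be the law on ℝᵏ of y + G and ν′ the law of y′ + G, where G has k independent coordinates each distributed as a centered Gaussian with standard deviation β (i.e., ν is the pushforward of the k-fold product of N(0, β²) under translation by y, and similarly for ν′). Then for every measurable set A ⊆ ℝᵏ, ν(A) ≤ e^ε · ν′(A) + δ. -/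
open MeasureTheory ProbabilityTheory

lemma gaussianReal_zero_Ioi_zero_le {v : NNReal} : gaussianReal 0 v (Set.Ioi 0) ≤ 2⁻¹ := by
  have hsymm : gaussianReal 0 v (Set.Iio 0) = gaussianReal 0 v (Set.Ioi 0) := by
    have h : (gaussianReal 0 v).map (fun x ↦ -x) = gaussianReal 0 v := by
      simpa using gaussianReal_map_neg (μ := 0) (v := v)
    conv_rhs => rw [← h, Measure.map_apply measurable_neg measurableSet_Ioi]
    simp
  have hsum : gaussianReal 0 v (Set.Ioi 0) + gaussianReal 0 v (Set.Iio 0) ≤ 1 := by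
    rw [← measure_union (by simp) measurableSet_Iio]
    exact prob_le_one
  rw [hsymm, ← two_mul] at hsum
  rw [← one_div]
  exact (ENNReal.le_div_iff_mul_le (by simp) (by simp)).2 (by rwa [mul_comm])

/-- Sub-Gaussian upper tail of the standard Gaussian, with the sharp constant `1/2`. -/
lemma gaussianReal_Ioi_le_of_nonneg {t : ℝ} (ht : 0 ≤ t) :
    gaussianReal 0 1 (Set.Ioi t) ≤ ENNReal.ofReal (Real.exp (-t ^ 2 / 2) / 2) := by
  have hshift : gaussianReal 0 1 (Set.Ioi t) = gaussianReal (-t) 1 (Set.Ioi 0) := by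
    have h := gaussianReal_map_add_const (μ := 0) (v := 1) (-t)
    rw [zero_add] at h
    rw [← h, Measure.map_apply (by fun_prop) measurableSet_Ioi]
    simp
  have hpdf : ∀ x ∈ Set.Ioi (0 : ℝ),
      gaussianPDF (-t) 1 x ≤ ENNReal.ofReal (Real.exp (-t ^ 2 / 2)) * gaussianPDF 0 1 x := by
    intro x hx
    rw [gaussianPDF, gaussianPDF, ← ENNReal.ofReal_mul (Real.exp_nonneg _)]
    apply ENNReal.ofReal_le_ofReal
    rw [gaussianPDFReal, gaussianPDFReal, mul_left_comm, ← Real.exp_add]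
    gcongr
    have := mul_nonneg ht (le_of_lt hx)
    simp only [NNReal.coe_one]
    nlinarith
  rw [hshift, gaussianReal_apply _ one_ne_zero]
  calc _ ≤ ∫⁻ x in Set.Ioi 0,
        ENNReal.ofReal (Real.exp (-t ^ 2 / 2)) * gaussianPDF 0 1 x :=
        setLIntegral_mono (by fun_prop) hpdf
    _ = ENNReal.ofReal (Real.exp (-t ^ 2 / 2)) * gaussianReal 0 1 (Set.Ioi 0) := by
        rw [lintegral_const_mul _ (by fun_prop), gaussianReal_apply _ one_ne_zero]
    _ ≤ ENNReal.ofReal (Real.exp (-t ^ 2 / 2)) * 2⁻¹ := by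
        gcongr; exact gaussianReal_zero_Ioi_zero_le
    _ = _ := by
        rw [div_eq_mul_inv (Real.exp _), ENNReal.ofReal_mul (Real.exp_nonneg _),
          ENNReal.ofReal_inv_of_pos two_pos, ENNReal.ofReal_ofNat]

lemma gaussianReal_Ioi_le_of_nonpos {t : ℝ} (ht : t ≤ 0) :
    gaussianReal 0 1 (Set.Ioi t) ≤ ENNReal.ofReal ((1 - t) / 2) := by
  have hpdf : ∀ x, gaussianPDF 0 1 x ≤ ENNReal.ofReal 2⁻¹ := by
    intro x
    apply ENNReal.ofReal_le_ofReal
    rw [gaussianPDFReal, ← mul_one (2⁻¹ : ℝ)]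
    gcongr
    · refine Real.le_sqrt_of_sq_le ?_
      have := Real.pi_gt_three
      simp only [NNReal.coe_one]
      linarith
    · rw [Real.exp_le_one_iff]
      simp only [NNReal.coe_one]
      nlinarith [sq_nonneg (x - 0)]
  rw [← Set.Ioc_union_Ioi_eq_Ioi ht]
  refine (measure_union_le _ _).trans ?_
  have hIoc : gaussianReal 0 1 (Set.Ioc t 0) ≤ ENNReal.ofReal (-t / 2) := by
    rw [gaussianReal_apply _ one_ne_zero]
    refine (setLIntegral_mono measurable_const fun x _ ↦ hpdf x).trans_eq ?_
    rw [setLIntegral_const, Real.volume_Ioc, ← ENNReal.ofReal_mul (by norm_num)]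
    congr 1; ring
  have hIoi : gaussianReal 0 1 (Set.Ioi 0) ≤ ENNReal.ofReal 2⁻¹ := by
    rw [ENNReal.ofReal_inv_of_pos two_pos, ENNReal.ofReal_ofNat]
    exact gaussianReal_zero_Ioi_zero_le
  refine (add_le_add hIoc hIoi).trans_eq ?_
  rw [← ENNReal.ofReal_add (by linarith) (by norm_num)]
  congr 1; ring

lemma gaussianReal_Ioi_le_delta {δ c t : ℝ} (hδ : δ ∈ Set.Ioo (0 : ℝ) 1)
    (hc : c = Real.sqrt (2 * Real.log (1.25 / δ))) (ht : c - 1 / (2 * c) ≤ t) :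
    gaussianReal 0 1 (Set.Ioi t) ≤ ENNReal.ofReal δ := by
  obtain ⟨hδ0, hδ1⟩ := hδ
  have hdiv : δ / 1.25 = 4 / 5 * δ := by ring
  have hinv : (0.2 : ℝ) ≤ Real.log (1.25 / δ) := by
    have h := Real.one_sub_inv_le_log_of_pos (x := 1.25 / δ) (by positivity)
    rw [inv_div, hdiv] at h
    linarith
  have hc2 : c ^ 2 = 2 * Real.log (1.25 / δ) := by rw [hc, Real.sq_sqrt (by linarith)]
  have hc0 : 0.6 ≤ c := by
    rw [hc]; exact Real.le_sqrt_of_sq_le (by linarith)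
  have hexp : Real.exp (-c ^ 2 / 2) = 4 / 5 * δ := by
    rw [hc2, show -(2 * Real.log (1.25 / δ)) / 2 = -Real.log (1.25 / δ) by ring, Real.exp_neg,
      Real.exp_log (by positivity), inv_div, hdiv]
  refine (measure_mono (Set.Ioi_subset_Ioi ht)).trans ?_
  have hcpos : 0 < c := by linarith
  have hcinv : c * (1 / (2 * c)) = 1 / 2 := by field_simp
  set u := 1 / (2 * c) with hu
  have hu0 : 0 < u := by positivity
  rcases le_total 0 (c - u) with h | h
  · refine (gaussianReal_Ioi_le_of_nonneg h).trans (ENNReal.ofReal_le_ofReal ?_)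
    have h1 : Real.exp (-(c - u) ^ 2 / 2) ≤ Real.exp (-c ^ 2 / 2) * Real.exp (1 / 2) := by
      rw [← Real.exp_add]
      gcongr
      nlinarith
    have h2 : Real.exp (1 / 2) ≤ 2 := by
      have h3 : Real.exp (1 / 2) ^ 2 = Real.exp 1 := by rw [← Real.exp_nat_mul]; norm_num
      have := Real.exp_one_lt_d9
      nlinarith [Real.exp_pos (1 / 2)]
    rw [hexp] at h1
    have h4 := mul_le_mul_of_nonneg_left h2 (show 0 ≤ 4 / 5 * δ by positivity)
    linarith
  · refine (gaussianReal_Ioi_le_of_nonpos h).trans (ENNReal.ofReal_le_ofReal ?_)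
    have h1 : c ^ 2 ≤ 1 / 2 := by nlinarith
    have h2 := Real.add_one_le_exp (-c ^ 2 / 2)
    rw [hexp] at h2
    have h3 : u ≤ 1 := by nlinarith
    linarith

lemma pi_withDensity_eq {ι : Type*} [Fintype ι] {α : ι → Type*} [∀ i, MeasurableSpace (α i)]
    (μ : ∀ i, Measure (α i)) [∀ i, IsProbabilityMeasure (μ i)] {f : ∀ i, α i → ENNReal}
    (hf : ∀ i, Measurable (f i)) [∀ i, SigmaFinite ((μ i).withDensity (f i))] :
    Measure.pi (fun i ↦ (μ i).withDensity (f i)) =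
      (Measure.pi μ).withDensity (fun x ↦ ∏ i, f i (x i)) := by
  refine Measure.pi_eq fun s hs ↦ ?_
  have hind : iIndepFun (fun i (x : ∀ i, α i) ↦ (s i).indicator (f i) (x i)) (Measure.pi μ) :=
    iIndepFun_pi fun i ↦ ((hf i).indicator (hs i)).aemeasurable
  have hprod (x : ∀ i, α i) : (Set.univ.pi s).indicator (fun x ↦ ∏ i, f i (x i)) x =
      ∏ i, (s i).indicator (f i) (x i) := by
    classical
    by_cases hx : x ∈ Set.univ.pi s
    · rw [Set.indicator_of_mem hx]
      exact Finset.prod_congr rfl fun i _ ↦ (Set.indicator_of_mem (hx i trivial) _).symm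
    · rw [Set.indicator_of_notMem hx]
      obtain ⟨i, hi⟩ : ∃ i, x i ∉ s i := by simpa [Set.mem_pi] using hx
      exact (Finset.prod_eq_zero (Finset.mem_univ i) (Set.indicator_of_notMem hi _)).symm
  rw [withDensity_apply _ (.univ_pi hs), ← lintegral_indicator (.univ_pi hs)]
  simp_rw [hprod]
  rw [lintegral_prod_eq_prod_lintegral_of_indepFun Finset.univ _ hind
    fun i ↦ ((hf i).indicator (hs i)).comp (measurable_pi_apply i)]
  refine Finset.prod_congr rfl fun i _ ↦ ?_
  rw [withDensity_apply _ (hs i), ← lintegral_indicator (hs i)]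
  exact (measurePreserving_eval μ i).lintegral_comp ((hf i).indicator (hs i))

lemma gaussianReal_eq_withDensity (m m' : ℝ) {v : NNReal} (hv : v ≠ 0) :
    gaussianReal m v = (gaussianReal m' v).withDensity
      (fun x ↦ ENNReal.ofReal (Real.exp (((x - m') ^ 2 - (x - m) ^ 2) / (2 * v)))) := by
  rw [gaussianReal_of_var_ne_zero m' hv, ← withDensity_mul _ (by fun_prop) (by fun_prop),
    gaussianReal_of_var_ne_zero m hv]
  congr 1
  ext x
  rw [Pi.mul_apply, gaussianPDF, gaussianPDF,
    ← ENNReal.ofReal_mul (gaussianPDFReal_nonneg _ _ _), gaussianPDFReal, gaussianPDFReal,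
    mul_assoc (_⁻¹), ← Real.exp_add]
  congr 3
  ring

lemma pi_gaussianReal_eq_withDensity {ι : Type*} [Fintype ι] (m m' : ι → ℝ) {v : NNReal}
    (hv : v ≠ 0) :
    Measure.pi (fun i ↦ gaussianReal (m i) v) =
      (Measure.pi fun i ↦ gaussianReal (m' i) v).withDensity (fun x ↦ ENNReal.ofReal
        (Real.exp (∑ i, ((x i - m' i) ^ 2 - (x i - m i) ^ 2) / (2 * v)))) := by
  have h (i : ι) := gaussianReal_eq_withDensity (m i) (m' i) hv
  have (i : ι) : SigmaFinite ((gaussianReal (m' i) v).withDensity (fun x ↦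
      ENNReal.ofReal (Real.exp (((x - m' i) ^ 2 - (x - m i) ^ 2) / (2 * v))))) := by
    rw [← h i]; infer_instance
  simp_rw [h]
  rw [pi_withDensity_eq _ fun i ↦ by fun_prop]
  congr 1
  ext x
  rw [Real.exp_sum, ENNReal.ofReal_prod_of_nonneg fun i _ ↦ Real.exp_nonneg _]

lemma map_const_add_pi_gaussianReal {ι : Type*} [Fintype ι] (m : ι → ℝ) (v : NNReal) :
    (Measure.pi fun _ : ι ↦ gaussianReal 0 v).map (fun g ↦ m + g) =
      Measure.pi (fun i ↦ gaussianReal (m i) v) := by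
  have h (i : ι) : (gaussianReal 0 v).map (fun x ↦ m i + x) = gaussianReal (m i) v := by
    rw [gaussianReal_map_const_add, zero_add]
  have (i : ι) : SigmaFinite ((gaussianReal 0 v).map (fun x ↦ m i + x)) := by
    rw [h i]; infer_instance
  simp_rw [← h]
  exact Measure.pi_map_pi (f := fun i x ↦ m i + x) fun i ↦ by fun_prop

lemma map_sum_mul_pi_gaussianReal {ι : Type*} [Fintype ι] (w : ι → ℝ) {β r : ℝ}
    (hr : r ^ 2 = ∑ i, w i ^ 2) :
    (Measure.pi fun _ : ι ↦ gaussianReal 0 (Real.toNNReal (β ^ 2))).map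
        (fun g ↦ ∑ i, w i * g i) =
      (gaussianReal 0 1).map (fun z ↦ β * r * z) := by
  have : IsProbabilityMeasure ((Measure.pi fun _ : ι ↦ gaussianReal 0 (Real.toNNReal (β ^ 2))).map
        (fun g ↦ ∑ i, w i * g i)) := Measure.isProbabilityMeasure_map
    (Measurable.aemeasurable (by fun_prop))
  have hind : iIndepFun (fun i (g : ι → ℝ) ↦ w i * g i)
      (Measure.pi fun _ : ι ↦ gaussianReal 0 (Real.toNNReal (β ^ 2))) :=
    iIndepFun_pi (X := fun i x ↦ w i * x) fun i ↦ by fun_prop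
  have hmap (i : ι) : (Measure.pi fun _ : ι ↦ gaussianReal 0 (Real.toNNReal (β ^ 2))).map
      (fun g ↦ w i * g i) = (gaussianReal 0 (Real.toNNReal (β ^ 2))).map (fun x ↦ w i * x) := by
    conv_rhs => rw [← (measurePreserving_eval
      (fun _ : ι ↦ gaussianReal 0 (Real.toNNReal (β ^ 2))) i).map_eq,
      Measure.map_map (by fun_prop) (by fun_prop)]
    rfl
  rw [gaussianReal_map_const_mul]
  apply Measure.ext_of_charFun
  rw [hind.charFun_map_fun_sum_eq_prod fun i ↦ Measurable.aemeasurable (by fun_prop)]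
  ext t
  simp_rw [hmap, gaussianReal_map_const_mul, Finset.prod_apply, charFun_gaussianReal,
    ← Complex.exp_sum]
  congr 1
  have hr' : (r : ℂ) ^ 2 = ∑ i, (w i : ℂ) ^ 2 := by exact_mod_cast hr
  simp only [mul_zero, Complex.ofReal_zero, zero_mul, zero_sub, mul_one, NNReal.coe_mul,
    NNReal.coe_mk, Real.coe_toNNReal _ (sq_nonneg β), mul_pow, Complex.ofReal_mul,
    Complex.ofReal_pow, Finset.sum_neg_distrib, ← Finset.sum_div, ← Finset.sum_mul, hr']
  ring

/-- If the privacy loss `L` of `ν` with respect to `ν'` exceeds `ε` with `ν`-probability at most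
`δ`, then `ν` and `ν'` are `(ε, δ)`-indistinguishable. -/
lemma withDensity_exp_apply_le {Ω : Type*} [MeasurableSpace Ω] {ν ν' : Measure Ω} {L : Ω → ℝ}
    (hL : Measurable L) (hν : ν = ν'.withDensity (fun x ↦ ENNReal.ofReal (Real.exp (L x))))
    {ε δ : ℝ} (htail : ν {x | ε < L x} ≤ ENNReal.ofReal δ) {A : Set Ω} (hA : MeasurableSet A) :
    ν A ≤ ENNReal.ofReal (Real.exp ε) * ν' A + ENNReal.ofReal δ := by
  have hG : MeasurableSet {x | L x ≤ ε} := measurableSet_le hL measurable_const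
  have hsub : A ⊆ (A ∩ {x | L x ≤ ε}) ∪ {x | ε < L x} := fun x hx ↦
    (le_or_gt (L x) ε).imp (fun h ↦ ⟨hx, h⟩) id
  refine (measure_mono hsub).trans ((measure_union_le _ _).trans (add_le_add ?_ htail))
  rw [hν, withDensity_apply _ (hA.inter hG)]
  calc _ ≤ ∫⁻ _ in A ∩ {x | L x ≤ ε}, ENNReal.ofReal (Real.exp ε) ∂ν' :=
        setLIntegral_mono measurable_const fun x hx ↦
          ENNReal.ofReal_le_ofReal (Real.exp_le_exp.2 hx.2)
    _ = ENNReal.ofReal (Real.exp ε) * ν' (A ∩ {x | L x ≤ ε}) := setLIntegral_const _ _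
    _ ≤ _ := by gcongr; exact Set.inter_subset_left

/-- The Gaussian mechanism: adding i.i.d. `N(0, β²)` noise with
`β = Δ√(2 ln(1.25/δ))/ε` to vectors `y, y'` at `ℓ₂`-distance at most `Δ` yields
output distributions `ν, ν'` satisfying the `(ε, δ)`-indistinguishability
inequality `ν(A) ≤ e^ε ν'(A) + δ` for every measurable `A`. -/
theorem stmt6 (k : ℕ) (ε δ Δ : ℝ) (hε : ε ∈ Set.Ioc (0 : ℝ) 1)
    (hδ : δ ∈ Set.Ioo (0 : ℝ) 1) (hΔ : 0 ≤ Δ)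
    (β : ℝ) (hβ : β = Δ * Real.sqrt (2 * Real.log (1.25 / δ)) / ε)
    (y y' : Fin k → ℝ) (hyy' : Real.sqrt (∑ i, (y i - y' i) ^ 2) ≤ Δ)
    (ν ν' : Measure (Fin k → ℝ))
    (hν : ν = Measure.map (fun g => y + g)
      (Measure.pi fun _ : Fin k => gaussianReal 0 (Real.toNNReal (β ^ 2))))
    (hν' : ν' = Measure.map (fun g => y' + g)
      (Measure.pi fun _ : Fin k => gaussianReal 0 (Real.toNNReal (β ^ 2)))) :
    ∀ A : Set (Fin k → ℝ), MeasurableSet A →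
      ν A ≤ ENNReal.ofReal (Real.exp ε) * ν' A + ENNReal.ofReal δ := by
  intro A hA
  obtain ⟨hε0, hε1⟩ := hε
  have hsum0 : 0 ≤ ∑ i, (y i - y' i) ^ 2 := Finset.sum_nonneg fun i _ ↦ sq_nonneg _
  set r := Real.sqrt (∑ i, (y i - y' i) ^ 2) with hr
  have hr2 : r ^ 2 = ∑ i, (y i - y' i) ^ 2 := Real.sq_sqrt hsum0
  have hr_nonneg : 0 ≤ r := Real.sqrt_nonneg _
  rcases hr_nonneg.eq_or_lt with hr0 | hr0
  · have hyy : y = y' := by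
      ext i
      rw [← hr0, eq_comm, zero_pow two_ne_zero, Finset.sum_eq_zero_iff_of_nonneg
        fun i _ ↦ sq_nonneg _] at hr2
      exact sub_eq_zero.1 (pow_eq_zero_iff two_ne_zero |>.1 (hr2 i (Finset.mem_univ i)))
    have hνν : ν = ν' := by rw [hν, hν', hyy]
    rw [hνν]
    refine le_add_right (le_mul_of_one_le_left zero_le ?_)
    exact ENNReal.one_le_ofReal.2 (Real.one_le_exp hε0.le)
  have hΔ0 : 0 < Δ := hr0.trans_le hyy'
  have hlog : 0 < Real.log (1.25 / δ) :=
    Real.log_pos ((one_lt_div hδ.1).2 (by linarith [hδ.2]))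
  set c := Real.sqrt (2 * Real.log (1.25 / δ)) with hc
  have hc0 : 0 < c := Real.sqrt_pos.2 (by positivity)
  have hβ0 : 0 < β := by rw [hβ]; positivity
  have hv : Real.toNNReal (β ^ 2) ≠ 0 := by simpa using hβ0.ne'
  have hvβ : ((Real.toNNReal (β ^ 2) : NNReal) : ℝ) = β ^ 2 := Real.coe_toNNReal _ (sq_nonneg _)
  have hdens := pi_gaussianReal_eq_withDensity y y' hv
  rw [← map_const_add_pi_gaussianReal y, ← map_const_add_pi_gaussianReal y', ← hν, ← hν'] at hdens
  refine withDensity_exp_apply_le (by fun_prop) hdens ?_ hA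
  have hloss (g : Fin k → ℝ) :
      ∑ i, (((y + g) i - y' i) ^ 2 - ((y + g) i - y i) ^ 2) / (2 * β ^ 2) =
        (r ^ 2 + 2 * ∑ i, (y i - y' i) * g i) / (2 * β ^ 2) := by
    rw [← Finset.sum_div, hr2, Finset.mul_sum, ← Finset.sum_add_distrib]
    congr 1
    refine Finset.sum_congr rfl fun i _ ↦ ?_
    rw [Pi.add_apply]; ring
  rw [hν, Measure.map_apply (by fun_prop) (measurableSet_lt (by fun_prop) (by fun_prop))]
  have hset : (fun g ↦ y + g) ⁻¹' {x | ε < ∑ i, ((x i - y' i) ^ 2 - (x i - y i) ^ 2) /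
      (2 * (Real.toNNReal (β ^ 2) : ℝ))} =
      (fun g ↦ ∑ i, (y i - y' i) * g i) ⁻¹' Set.Ioi (ε * β ^ 2 - r ^ 2 / 2) := by
    ext g
    simp only [hvβ, Set.mem_preimage, Set.mem_ofPred_eq, hloss, Set.mem_Ioi]
    rw [lt_div_iff₀ (by positivity)]
    constructor <;> intro h <;> linarith
  rw [hset, ← Measure.map_apply (by fun_prop) measurableSet_Ioi,
    map_sum_mul_pi_gaussianReal _ hr2, Measure.map_apply (by fun_prop) measurableSet_Ioi]
  have hpre : (fun z ↦ β * r * z) ⁻¹' Set.Ioi (ε * β ^ 2 - r ^ 2 / 2) =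
      Set.Ioi (ε * β / r - r / (2 * β)) := by
    ext z
    have h : ε * β ^ 2 - r ^ 2 / 2 = β * r * (ε * β / r - r / (2 * β)) := by field_simp
    simp only [Set.mem_preimage, Set.mem_Ioi]
    rw [h, mul_lt_mul_iff_right₀ (by positivity)]
  rw [hpre]
  refine gaussianReal_Ioi_le_delta hδ hc ?_
  have h1 : c ≤ ε * β / r := by
    rw [hβ, le_div_iff₀ hr0, mul_div_cancel₀ _ hε0.ne', mul_comm]
    gcongr
  have h2 : r / (2 * β) ≤ 1 / (2 * c) := by
    rw [div_le_div_iff₀ (by positivity) (by positivity), hβ]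
    have : Δ * c ≤ Δ * c / ε := by rw [le_div_iff₀ hε0]; nlinarith [mul_pos hΔ0 hc0]
    nlinarith
  linarith
end

section
/- Let S be a real symmetric positive semidefinite p×p matrix and λ > 0. Then the graphical lasso objective Θ ↦ −log det Θ + tr(SΘ) + λ‖Θ‖₁ attains its infimum over the set of real symmetric positive definite p×p matrices, and the minimizer is unique. -/
open scoped Matrix

namespace Matrix

section Auxiliary

variable {n : Type*} [Fintype n]

lemma isClosed_setOf_posSemidef : IsClosed {A : Matrix n n ℝ | A.PosSemidef} := by
  have : {A : Matrix n n ℝ | A.PosSemidef} =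
      {A | Aᴴ = A} ∩ ⋂ x : n → ℝ, {A | 0 ≤ star x ⬝ᵥ (A *ᵥ x)} := by
    ext A
    simp [posSemidef_iff_dotProduct_mulVec, IsHermitian]
  rw [this]
  exact (isClosed_eq (by fun_prop) continuous_id).inter
    (isClosed_iInter fun x => isClosed_le continuous_const (by fun_prop))

lemma abs_apply_le_sum_abs (A : Matrix n n ℝ) (i j : n) : |A i j| ≤ ∑ i, ∑ j, |A i j| :=
  (Finset.single_le_sum (f := fun j => |A i j|) (fun _ _ => abs_nonneg _)
    (Finset.mem_univ j)).trans
    (Finset.single_le_sum (f := fun i => ∑ j, |A i j|)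
      (fun _ _ => Finset.sum_nonneg fun _ _ => abs_nonneg _) (Finset.mem_univ i))

lemma trace_le_sum_abs (A : Matrix n n ℝ) : A.trace ≤ ∑ i, ∑ j, |A i j| :=
  Finset.sum_le_sum fun i _ => (le_abs_self _).trans
    (Finset.single_le_sum (f := fun j => |A i j|) (fun _ _ => abs_nonneg _) (Finset.mem_univ i))

lemma isCompact_setOf_sum_abs_le (R : ℝ) :
    IsCompact {A : Matrix n n ℝ | ∑ i, ∑ j, |A i j| ≤ R} := by
  have hbox : IsCompact (Set.univ.pi fun _ : n => Set.univ.pi fun _ : n => Set.Icc (-R) R) :=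
    isCompact_univ_pi fun _ => isCompact_univ_pi fun _ => isCompact_Icc
  refine hbox.of_isClosed_subset (isClosed_le (by fun_prop) continuous_const) ?_
  intro A hA i _ j _
  exact abs_le.mp ((abs_apply_le_sum_abs A i j).trans hA)

variable [DecidableEq n]

/-- Away from the identity matrix, `log det X < tr X - n`. -/
lemma PosDef.log_det_lt_trace_sub_card {X : Matrix n n ℝ} (hX : X.PosDef) (hne : X ≠ 1) :
    Real.log X.det < X.trace - Fintype.card n := by
  obtain ⟨i, hi⟩ : ∃ i, hX.1.eigenvalues i ≠ 1 := by
    by_contra! h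
    apply hne
    rw [hX.1.spectral_theorem, show hX.1.eigenvalues = 1 from funext h]
    have : (RCLike.ofReal ∘ (1 : n → ℝ) : n → ℝ) = fun _ => 1 := by ext; simp
    rw [this, diagonal_one, map_one]
  rw [hX.1.det_eq_prod_eigenvalues, hX.1.trace_eq_sum_eigenvalues]
  simp only [RCLike.ofReal_real_eq_id, id_eq]
  rw [Real.log_prod fun i _ => (hX.eigenvalues_pos i).ne']
  calc ∑ i, Real.log (hX.1.eigenvalues i) < ∑ i, (hX.1.eigenvalues i - 1) :=
        Finset.sum_lt_sum
          (fun i _ => Real.log_le_sub_one_of_pos (hX.eigenvalues_pos i))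
          ⟨i, Finset.mem_univ i, Real.log_lt_sub_one_of_pos (hX.eigenvalues_pos i) hi⟩
    _ = _ := by simp

/-- The linear upper bound `log det X ≤ tr X - n` of the concave function `log det`. -/
lemma PosDef.log_det_le_trace_sub_card {X : Matrix n n ℝ} (hX : X.PosDef) :
    Real.log X.det ≤ X.trace - Fintype.card n := by
  rcases eq_or_ne X 1 with rfl | hne
  · simp
  · exact (hX.log_det_lt_trace_sub_card hne).le

open scoped MatrixOrder in
lemma PosSemidef.exists_eq_conjTranspose_mul_self {P : Matrix n n ℝ} (hP : P.PosSemidef) :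
    ∃ B : Matrix n n ℝ, P = Bᴴ * B :=
  CStarAlgebra.nonneg_iff_eq_star_mul_self.mp hP.nonneg

/-- The trace of a product of positive semidefinite matrices is nonnegative. -/
lemma PosSemidef.trace_mul_nonneg_real {P A : Matrix n n ℝ} (hP : P.PosSemidef)
    (hA : A.PosSemidef) : 0 ≤ (P * A).trace := by
  obtain ⟨B, rfl⟩ := hP.exists_eq_conjTranspose_mul_self
  rw [mul_assoc, trace_mul_comm]
  exact (hA.mul_mul_conjTranspose_same B).trace_nonneg

/-- The tangent plane of `log det` at `M` lies strictly above its graph away from `M`. -/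
lemma PosDef.log_det_lt_log_det_add_trace {M A : Matrix n n ℝ} (hM : M.PosDef) (hA : A.PosDef)
    (hne : A ≠ M) :
    Real.log A.det < Real.log M.det + (M⁻¹ * A).trace - Fintype.card n := by
  obtain ⟨B, hB⟩ := hM.inv.posSemidef.exists_eq_conjTranspose_mul_self
  have hMdet := hM.det_pos
  have hAdet := hA.det_pos
  have hdet : B.det * B.det = M.det⁻¹ := by
    have := congrArg det hB
    rw [det_mul, det_conjTranspose, det_nonsing_inv, Ring.inverse_eq_inv'] at this
    simpa using this.symm
  have hB0 : B.det ≠ 0 := by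
    intro h
    rw [h, mul_zero] at hdet
    exact (inv_pos.mpr hMdet).ne hdet
  have hBu : IsUnit B := (isUnit_iff_isUnit_det B).mpr hB0.isUnit
  have hX : (B * A * Bᴴ).PosDef :=
    hA.mul_mul_conjTranspose_same (vecMul_injective_iff_isUnit.mpr hBu)
  have hX1 : B * A * Bᴴ ≠ 1 := by
    intro h
    apply hne
    have h1 : A * Bᴴ * B = 1 := by
      rw [mul_assoc] at h
      exact mul_eq_one_comm.mp h
    rw [mul_assoc, ← hB] at h1
    have h2 := congrArg (· * M) h1
    simpa [mul_assoc, nonsing_inv_mul M hMdet.ne'.isUnit] using h2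
  have key := hX.log_det_lt_trace_sub_card hX1
  have hdetX : (B * A * Bᴴ).det = A.det * M.det⁻¹ := by
    rw [← hdet, det_mul, det_mul, det_conjTranspose]
    simp only [star_trivial]
    ring
  have htr : (B * A * Bᴴ).trace = (M⁻¹ * A).trace := by
    rw [hB, trace_mul_comm, mul_assoc]
  rw [hdetX, htr, Real.log_mul hAdet.ne' (inv_pos.mpr hMdet).ne', Real.log_inv] at key
  linarith

/-- Strict midpoint concavity of `log det` on the positive definite matrices. -/
lemma PosDef.log_det_add_log_det_lt {A B : Matrix n n ℝ} (hA : A.PosDef) (hB : B.PosDef)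
    (hne : A ≠ B) :
    Real.log A.det + Real.log B.det < 2 * Real.log ((1 / 2 : ℝ) • (A + B)).det := by
  set M := (1 / 2 : ℝ) • (A + B) with hMdef
  have hM : M.PosDef := (hA.add hB).smul (by norm_num)
  have hAB : A + B = (2 : ℝ) • M := by rw [hMdef, smul_smul]; norm_num
  have hAM : A ≠ M := by
    intro h
    apply hne
    rw [← h, two_smul] at hAB
    exact (add_left_cancel hAB).symm
  have hBM : B ≠ M := by
    intro h
    apply hne
    rw [← h, two_smul] at hAB
    exact add_right_cancel hAB
  have h1 := hM.log_det_lt_log_det_add_trace hA hAM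
  have h2 := hM.log_det_lt_log_det_add_trace hB hBM
  have h3 : (M⁻¹ * A).trace + (M⁻¹ * B).trace = 2 * Fintype.card n := by
    rw [← trace_add, ← mul_add, hAB, mul_smul_comm,
      nonsing_inv_mul M hM.det_pos.ne'.isUnit, trace_smul, trace_one, smul_eq_mul]
  linarith

/-- The graphical lasso objective with data matrix `S` and penalty `lam`. -/
noncomputable def glassoObjective (S : Matrix n n ℝ) (lam : ℝ) (Θ : Matrix n n ℝ) : ℝ :=
  -Real.log Θ.det + (S * Θ).trace + lam * ∑ i, ∑ j, |Θ i j|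

/-- Coercivity: the objective controls the entrywise `ℓ₁`-norm. -/
lemma glassoObjective_coercive {S : Matrix n n ℝ} (hS : S.PosSemidef) {lam : ℝ} (hlam : 0 < lam)
    {Θ : Matrix n n ℝ} (hΘ : Θ.PosDef) :
    lam / 2 * ∑ i, ∑ j, |Θ i j| + Fintype.card n * (1 + Real.log (lam / 2)) ≤
      glassoObjective S lam Θ := by
  have hc : 0 < lam / 2 := half_pos hlam
  have h := (hΘ.smul hc).log_det_le_trace_sub_card
  rw [det_smul, Real.log_mul (pow_pos hc _).ne' hΘ.det_pos.ne', Real.log_pow, trace_smul,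
    smul_eq_mul] at h
  have h1 := hS.trace_mul_nonneg_real hΘ.posSemidef
  have h2 := mul_le_mul_of_nonneg_left (trace_le_sum_abs Θ) hc.le
  unfold glassoObjective
  linarith

lemma glassoObjective_midpoint_lt (S : Matrix n n ℝ) {lam : ℝ} (hlam : 0 < lam)
    {A B : Matrix n n ℝ} (hA : A.PosDef) (hB : B.PosDef) (hne : A ≠ B) :
    2 * glassoObjective S lam ((1 / 2 : ℝ) • (A + B)) <
      glassoObjective S lam A + glassoObjective S lam B := by
  have h1 := hA.log_det_add_log_det_lt hB hne
  have h2 : (S * ((1 / 2 : ℝ) • (A + B))).trace = ((S * A).trace + (S * B).trace) / 2 := by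
    rw [mul_smul_comm, trace_smul, mul_add, trace_add, smul_eq_mul]
    ring
  have h3 : ∑ i, ∑ j, |((1 / 2 : ℝ) • (A + B)) i j| ≤
      (∑ i, ∑ j, |A i j| + ∑ i, ∑ j, |B i j|) / 2 := by
    rw [← Finset.sum_add_distrib, Finset.sum_div]
    refine Finset.sum_le_sum fun i _ => ?_
    rw [← Finset.sum_add_distrib, Finset.sum_div]
    refine Finset.sum_le_sum fun j _ => ?_
    rw [smul_apply, add_apply, smul_eq_mul, abs_mul, abs_of_pos (by norm_num : (0 : ℝ) < 1 / 2)]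
    linarith [abs_add_le (A i j) (B i j)]
  have h4 := mul_le_mul_of_nonneg_left h3 hlam.le
  unfold glassoObjective
  rw [h2]
  linarith

lemma exists_glassoObjective_minimizer {S : Matrix n n ℝ} (hS : S.PosSemidef) {lam : ℝ}
    (hlam : 0 < lam) :
    ∃ Θhat : Matrix n n ℝ, Θhat.PosDef ∧
      ∀ Θ : Matrix n n ℝ, Θ.PosDef → glassoObjective S lam Θhat ≤ glassoObjective S lam Θ := by
  set c := glassoObjective S lam 1 with hc
  set R := (c - Fintype.card n * (1 + Real.log (lam / 2))) / (lam / 2) with hR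
  set K : Set (Matrix n n ℝ) :=
    {A | ∑ i, ∑ j, |A i j| ≤ R} ∩ ({A | A.PosSemidef} ∩ {A | Real.exp (-c) ≤ A.det}) with hK
  have hKc : IsCompact K := (isCompact_setOf_sum_abs_le R).inter_right
    (isClosed_setOf_posSemidef.inter (isClosed_le continuous_const (by fun_prop)))
  have hmem : ∀ Θ : Matrix n n ℝ, Θ.PosDef → glassoObjective S lam Θ ≤ c → Θ ∈ K := by
    intro Θ hΘ hle
    refine ⟨?_, hΘ.posSemidef, ?_⟩
    · have h := glassoObjective_coercive hS hlam hΘ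
      change _ ≤ R
      rw [hR, le_div_iff₀ (half_pos hlam)]
      linarith
    · have h1 := hS.trace_mul_nonneg_real hΘ.posSemidef
      have h2 : 0 ≤ lam * ∑ i, ∑ j, |Θ i j| := by positivity
      change _ ≤ Θ.det
      rw [← Real.le_log_iff_exp_le hΘ.det_pos]
      unfold glassoObjective at hle
      linarith
  have hdet : ∀ Θ ∈ K, 0 < Θ.det := fun Θ hΘ => (Real.exp_pos _).trans_le hΘ.2.2
  have hcont : ContinuousOn (glassoObjective S lam) K := by
    unfold glassoObjective
    refine ContinuousOn.add (ContinuousOn.add (ContinuousOn.neg (ContinuousOn.log ?_ ?_)) ?_) ?_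
    · exact Continuous.continuousOn (by fun_prop)
    · exact fun Θ hΘ => (hdet Θ hΘ).ne'
    · exact Continuous.continuousOn (by fun_prop)
    · exact Continuous.continuousOn (by fun_prop)
  have h1K : (1 : Matrix n n ℝ) ∈ K := hmem 1 .one hc.ge
  obtain ⟨Θhat, hΘhat, hmin⟩ := hKc.exists_isMinOn ⟨1, h1K⟩ hcont
  refine ⟨Θhat, hΘhat.2.1.posDef_iff_det_ne_zero.mpr (hdet _ hΘhat).ne', fun Θ hΘ => ?_⟩
  rcases le_total (glassoObjective S lam Θ) c with h | h
  · exact hmin (hmem Θ hΘ h)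
  · exact (hmin h1K).trans h

end Auxiliary

end Matrix

/-- For `S` real symmetric positive semidefinite and `λ > 0`,
the graphical lasso objective `Θ ↦ −log det Θ + tr(SΘ) + λ‖Θ‖₁` attains its
infimum over the symmetric positive definite matrices, at a unique minimizer. -/
theorem stmt16 {p : ℕ} (S : Matrix (Fin p) (Fin p) ℝ) (hS : S.PosSemidef)
    (lam : ℝ) (hlam : 0 < lam) :
    ∃! Θhat : Matrix (Fin p) (Fin p) ℝ, Θhat.PosDef ∧
      ∀ Θ : Matrix (Fin p) (Fin p) ℝ, Θ.PosDef →
        -Real.log Θhat.det + (S * Θhat).trace + lam * ∑ i, ∑ j, |Θhat i j| ≤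
          -Real.log Θ.det + (S * Θ).trace + lam * ∑ i, ∑ j, |Θ i j| := by
  obtain ⟨Θhat, hpd, hmin⟩ := Matrix.exists_glassoObjective_minimizer hS hlam
  refine ⟨Θhat, ⟨hpd, hmin⟩, ?_⟩
  rintro Θ ⟨hΘ, hΘmin⟩
  by_contra hne
  have hM : ((1 / 2 : ℝ) • (Θ + Θhat)).PosDef := (hΘ.add hpd).smul (by norm_num)
  have h1 := Matrix.glassoObjective_midpoint_lt S hlam hΘ hpd hne
  have h2 : S.glassoObjective lam Θ ≤ _ := hΘmin _ hM
  have h3 := hmin _ hM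
  unfold Matrix.glassoObjective at h1 h2 h3
  linarith
end
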